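/- (Reflection comparison for the first eigenfunction.) Let s ∈ (0, r1−r0) and let y_{1,s} be a first eigenfunction of Ω(s). Assume moreover that for every continuous nonnegative boundary datum h' on the boundary of the half-domain O = {x ∈ Ω(s) : x1 > s}, the problem −Δ_p w = λ1(Ω(s)) |w|^{p−2} w in O, w = h' on ∂O, has exactly one nonnegative bounded weak solution continuous on the closure of O. Then for every x = (x1,…,xN) ∈ O one has y_{1,s}(x') ≥ y_{1,s}(x), where x' = (2s−x1, x2,…,xN) is the reflection of x across the hyperplane {x1 = s}. -/

import Mathlib

open MeasureTheory RealInnerProductSpace Metric Set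

noncomputable section

/-- Smooth test functions compactly supported in `U` (the class `C_c^∞(U)`). -/
def IsTestFun {N : ℕ} (U : Set (EuclideanSpace ℝ (Fin N)))
    (φ : EuclideanSpace ℝ (Fin N) → ℝ) : Prop :=
  ContDiff ℝ (⊤ : ℕ∞) φ ∧ HasCompactSupport φ ∧ tsupport φ ⊆ U

/-- `u` is a weak solution of `-Δ_p u = h` in `U`:
`∫_U |∇u|^{p-2} ⟨∇u, ∇φ⟩ = ∫_U h φ` for all test functions `φ`. -/
def IsWeakSolution (p : ℝ) {N : ℕ} (U : Set (EuclideanSpace ℝ (Fin N)))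
    (u h : EuclideanSpace ℝ (Fin N) → ℝ) : Prop :=
  ∀ φ : EuclideanSpace ℝ (Fin N) → ℝ, IsTestFun U φ →
    (∫ x in U, ‖gradient u x‖ ^ (p - 2) * ⟪gradient u x, gradient φ x⟫)
      = ∫ x in U, h x * φ x

/-- The `p`-torsional rigidity of `U`:
`E(U) = (p/(p-1)) ⬝ sup { ∫_U φ - (1/p) ∫_U |∇φ|^p : φ ∈ C_c^∞(U) }`. -/
def pTorsionalRigidity (p : ℝ) {N : ℕ} (U : Set (EuclideanSpace ℝ (Fin N))) : ℝ :=
  (p / (p - 1)) *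
    sSup { r : ℝ | ∃ φ, IsTestFun U φ ∧
      r = (∫ x in U, φ x) - (1 / p) * ∫ x in U, ‖gradient φ x‖ ^ p }

/-- The first Dirichlet eigenvalue of the `p`-Laplacian on `U`:
`λ₁(U) = inf { (∫_U |∇φ|^p)/(∫_U |φ|^p) : φ ∈ C_c^∞(U), φ ≢ 0 }`. -/
def pLambda1 (p : ℝ) {N : ℕ} (U : Set (EuclideanSpace ℝ (Fin N))) : ℝ :=
  sInf { r : ℝ | ∃ φ, IsTestFun U φ ∧ φ ≠ 0 ∧
    r = (∫ x in U, ‖gradient φ x‖ ^ p) / (∫ x in U, |φ x| ^ p) }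

/-- `f` is `C^1` on the closure of `U` (i.e. `C^1` on an open neighbourhood of it). -/
def C1OnClosure {N : ℕ} (U : Set (EuclideanSpace ℝ (Fin N)))
    (f : EuclideanSpace ℝ (Fin N) → ℝ) : Prop :=
  ∃ W, IsOpen W ∧ closure U ⊆ W ∧ ContDiffOn ℝ 1 f W

/-- `Ω` has a smooth boundary: it is the sublevel set of a smooth function whose
differential does not vanish on the boundary. -/
def HasSmoothBoundary {N : ℕ} (Ω : Set (EuclideanSpace ℝ (Fin N))) : Prop :=
  ∃ f : EuclideanSpace ℝ (Fin N) → ℝ, ContDiff ℝ (⊤ : ℕ∞) f ∧ Ω = f ⁻¹' Set.Iio 0 ∧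
    ∀ x ∈ frontier Ω, fderiv ℝ f x ≠ 0

/-- The index of the first coordinate. -/
def firstIdx (N : ℕ) (hN : 2 ≤ N) : Fin N := ⟨0, by omega⟩

/-- The first standard basis vector `e₁`. -/
def e1v {N : ℕ} (hN : 2 ≤ N) : EuclideanSpace ℝ (Fin N) :=
  EuclideanSpace.single (firstIdx N hN) 1

/-- The domain `Ω(s) = B(0,r1) \ closure B(s e₁, r0)`. -/
def annulus {N : ℕ} (hN : 2 ≤ N) (r0 r1 s : ℝ) : Set (EuclideanSpace ℝ (Fin N)) :=
  Metric.ball (0 : EuclideanSpace ℝ (Fin N)) r1 \ closure (Metric.ball (s • e1v hN) r0)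

/-- Reflection across the hyperplane `{x₁ = s}`: `x ↦ (2s - x₁, x₂, …, x_N)`. -/
def reflectH {N : ℕ} (hN : 2 ≤ N) (s : ℝ) (x : EuclideanSpace ℝ (Fin N)) :
    EuclideanSpace ℝ (Fin N) :=
  x + (2 * (s - x (firstIdx N hN))) • e1v hN

/-- The divergence of a vector field, as the trace of its Jacobian. -/
def divergence {N : ℕ} (V : EuclideanSpace ℝ (Fin N) → EuclideanSpace ℝ (Fin N))
    (x : EuclideanSpace ℝ (Fin N)) : ℝ :=
  LinearMap.trace ℝ _ (fderiv ℝ V x : EuclideanSpace ℝ (Fin N) →ₗ[ℝ] EuclideanSpace ℝ (Fin N))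

/-- The classical `p`-Laplacian `Δ_p b = div(|∇b|^{p-2} ∇b)` at a point. -/
def pLapAt (p : ℝ) {N : ℕ} (b : EuclideanSpace ℝ (Fin N) → ℝ)
    (x : EuclideanSpace ℝ (Fin N)) : ℝ :=
  divergence (fun z => ‖gradient b z‖ ^ (p - 2) • gradient b z) x

/-- The torsion function of `U`: `C^1` up to the boundary, vanishing on the boundary,
positive inside, weak solution of `-Δ_p y = 1`. -/
def IsTorsionFn (p : ℝ) {N : ℕ} (U : Set (EuclideanSpace ℝ (Fin N)))
    (y : EuclideanSpace ℝ (Fin N) → ℝ) : Prop :=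
  C1OnClosure U y ∧ (∀ x ∈ frontier U, y x = 0) ∧ (∀ x ∈ U, 0 < y x) ∧
    IsWeakSolution p U y (fun _ => 1)

/-- A first eigenfunction of the Dirichlet `p`-Laplacian on `U`: `C^1` up to the boundary,
positive inside, vanishing on the boundary, `L^p`-normalized, weak solution of
`-Δ_p u = λ₁(U) u^{p-1}`. -/
def IsFirstEigenfun (p : ℝ) {N : ℕ} (U : Set (EuclideanSpace ℝ (Fin N)))
    (y : EuclideanSpace ℝ (Fin N) → ℝ) : Prop :=
  C1OnClosure U y ∧ (∀ x ∈ U, 0 < y x) ∧ (∀ x ∈ frontier U, y x = 0) ∧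
    (∫ x in U, y x ^ p) = 1 ∧
    IsWeakSolution p U y (fun x => pLambda1 p U * y x ^ (p - 1))

/-- The matrix `DA(x) = |x|^{p-2} I + (p-2)|x|^{p-4} x xᵀ`,
the derivative of `A(x) = |x|^{p-2} x`. -/
def DA (p : ℝ) {N : ℕ} (x : EuclideanSpace ℝ (Fin N)) :
    EuclideanSpace ℝ (Fin N) →L[ℝ] EuclideanSpace ℝ (Fin N) :=
  ‖x‖ ^ (p - 2) • ContinuousLinearMap.id ℝ (EuclideanSpace ℝ (Fin N)) +
    ((p - 2) * ‖x‖ ^ (p - 4)) • (innerSL ℝ x).smulRight x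

/-- `w` is a nonnegative bounded weak solution, continuous on the closure of `Ω` and `C^1`
inside, of `-Δ_p w = F(x, w)` in `Ω` with boundary value `bdry` on `∂Ω`. -/
def SolClass (p : ℝ) {N : ℕ} (Ω : Set (EuclideanSpace ℝ (Fin N)))
    (F : EuclideanSpace ℝ (Fin N) → ℝ → ℝ)
    (bdry w : EuclideanSpace ℝ (Fin N) → ℝ) : Prop :=
  ContinuousOn w (closure Ω) ∧ ContDiffOn ℝ 1 w Ω ∧
    (∀ x ∈ closure Ω, 0 ≤ w x) ∧ (∃ M, ∀ x ∈ closure Ω, |w x| ≤ M) ∧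
    IsWeakSolution p Ω w (fun x => F x (w x)) ∧ (∀ x ∈ frontier Ω, w x = bdry x)

open Filter Topology

/-- The vector field `ξ ↦ |ξ|^{p-2} ξ`. -/
def pFlux {E : Type*} [NormedAddCommGroup E] [NormedSpace ℝ E] (p : ℝ) (ξ : E) : E :=
  ‖ξ‖ ^ (p - 2) • ξ

/-- The convexity gap `|a|^p - |b|^p - p ⟨|b|^{p-2} b, a - b⟩`. -/
def convexityGap {E : Type*} [NormedAddCommGroup E] [InnerProductSpace ℝ E] (p : ℝ) (a b : E) : ℝ :=
  ‖a‖ ^ p - p * ⟪pFlux p b, a⟫ + (p - 1) * ‖b‖ ^ p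

section Flux

variable {E : Type*} [NormedAddCommGroup E]

theorem norm_pFlux [NormedSpace ℝ E] {p : ℝ} (hp : 1 < p) (ξ : E) :
    ‖pFlux p ξ‖ = ‖ξ‖ ^ (p - 1) := by
  rcases eq_or_ne ξ 0 with rfl | h
  · simp [pFlux, Real.zero_rpow (by linarith : p - 1 ≠ 0)]
  · rw [pFlux, norm_smul, Real.norm_of_nonneg (by positivity),
      ← Real.rpow_add_one (by positivity)]
    ring_nf

theorem continuous_pFlux [NormedSpace ℝ E] {p : ℝ} (hp : 1 < p) :
    Continuous (pFlux p : E → E) := by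
  rw [continuous_iff_continuousAt]
  intro ξ
  rcases eq_or_ne ξ 0 with rfl | h
  · have h0 : pFlux p (0 : E) = 0 := by simp [pFlux]
    rw [ContinuousAt, h0, tendsto_zero_iff_norm_tendsto_zero]
    simp_rw [norm_pFlux hp]
    have : ContinuousAt (fun ξ : E => ‖ξ‖ ^ (p - 1)) 0 :=
      continuous_norm.continuousAt.rpow_const (Or.inr (by linarith))
    simpa [ContinuousAt, Real.zero_rpow (by linarith : p - 1 ≠ 0)] using this
  · exact (continuous_norm.continuousAt.rpow_const
      (Or.inl (norm_ne_zero_iff.2 h))).smul continuousAt_id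

theorem pFlux_smul [NormedSpace ℝ E] {p c : ℝ} (hc : 0 < c) (ξ : E) :
    pFlux p (c • ξ) = c ^ (p - 1) • pFlux p ξ := by
  rw [pFlux, pFlux, norm_smul, Real.norm_of_nonneg hc.le, Real.mul_rpow hc.le (norm_nonneg _),
    smul_smul, smul_smul, show p - 1 = p - 2 + 1 by ring, Real.rpow_add_one hc.ne']
  ring_nf

variable [InnerProductSpace ℝ E]

theorem inner_pFlux_self {p : ℝ} (hp : 1 < p) (ξ : E) : ⟪pFlux p ξ, ξ⟫ = ‖ξ‖ ^ p := by
  rcases eq_or_ne ξ 0 with rfl | h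
  · simp [Real.zero_rpow (by linarith : p ≠ 0)]
  · rw [pFlux, real_inner_smul_left, real_inner_self_eq_norm_sq, ← Real.rpow_natCast,
      ← Real.rpow_add (by positivity)]
    norm_num

theorem convexityGap_self {p : ℝ} (hp : 1 < p) (a : E) : convexityGap p a a = 0 := by
  rw [convexityGap, inner_pFlux_self hp]
  ring

theorem convexityGap_pos {p : ℝ} (hp : 1 < p) {a b : E} (hab : a ≠ b) :
    0 < convexityGap p a b := by
  rcases eq_or_ne b 0 with rfl | hb
  · have : 0 < ‖a‖ ^ p := Real.rpow_pos_of_pos (norm_pos_iff.2 hab) _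
    simpa [convexityGap, pFlux, Real.zero_rpow (by linarith : p ≠ 0)] using this
  · have hb' : 0 < ‖b‖ := norm_pos_iff.2 hb
    have hpow : ‖b‖ ^ (p - 2) * ‖b‖ ^ 2 = ‖b‖ ^ p := by
      rw [← Real.rpow_natCast, ← Real.rpow_add hb']
      norm_num
    have hpos : 0 < ‖b‖ ^ (p - 2) := Real.rpow_pos_of_pos hb' _
    rw [convexityGap, pFlux, real_inner_smul_left]
    by_cases hn : ‖a‖ = ‖b‖
    · have h1 : 0 < ‖a - b‖ ^ 2 := by
        have := norm_pos_iff.2 (sub_ne_zero.2 hab)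
        positivity
      rw [norm_sub_sq_real, real_inner_comm, hn] at h1
      have h2 : ‖b‖ ^ (p - 2) * ⟪b, a⟫ < ‖b‖ ^ (p - 2) * ‖b‖ ^ 2 := by
        gcongr
        linarith
      rw [hn]
      nlinarith
    · have h1 := one_add_mul_self_lt_rpow_one_add (s := ‖a‖ / ‖b‖ - 1)
        (by have : 0 ≤ ‖a‖ / ‖b‖ := by positivity
            linarith)
        (by rw [sub_ne_zero, ne_eq, div_eq_one_iff_eq hb'.ne']
            exact hn) hp
      rw [add_sub_cancel, Real.div_rpow (norm_nonneg _) hb'.le] at h1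
      have hbp : 0 < ‖b‖ ^ p := Real.rpow_pos_of_pos hb' _
      have h2 := (mul_lt_mul_iff_of_pos_right hbp).2 h1
      rw [div_mul_cancel₀ _ hbp.ne'] at h2
      have h3 : ‖b‖ ^ (p - 2) * ⟪b, a⟫ ≤ ‖a‖ / ‖b‖ * ‖b‖ ^ p := by
        rw [← hpow]
        have : ‖a‖ / ‖b‖ * (‖b‖ ^ (p - 2) * ‖b‖ ^ 2) = ‖b‖ ^ (p - 2) * (‖b‖ * ‖a‖) := by
          field_simp
        rw [this]
        gcongr
        exact real_inner_le_norm b a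
      nlinarith

theorem convexityGap_nonneg {p : ℝ} (hp : 1 < p) (a b : E) : 0 ≤ convexityGap p a b := by
  rcases eq_or_ne a b with rfl | h
  · rw [convexityGap_self hp]
  · exact (convexityGap_pos hp h).le

theorem inner_pFlux_sub_nonneg {p : ℝ} (hp : 1 < p) (a b : E) :
    0 ≤ ⟪pFlux p a - pFlux p b, a - b⟫ := by
  have h1 := convexityGap_nonneg hp a b
  have h2 := convexityGap_nonneg hp b a
  rw [convexityGap] at h1 h2
  rw [inner_sub_left, inner_sub_right, inner_sub_right, inner_pFlux_self hp, inner_pFlux_self hp]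
  nlinarith

theorem continuous_convexityGap {p : ℝ} (hp : 1 < p) :
    Continuous fun z : E × E => convexityGap p z.1 z.2 := by
  have h := continuous_pFlux (E := E) hp
  have h1 : Continuous fun z : E × E => ‖z.1‖ ^ p :=
    continuous_fst.norm.rpow_const fun _ => Or.inr (by linarith)
  have h2 : Continuous fun z : E × E => ‖z.2‖ ^ p :=
    continuous_snd.norm.rpow_const fun _ => Or.inr (by linarith)
  unfold convexityGap
  exact (h1.sub (continuous_const.mul ((h.comp continuous_snd).inner continuous_fst))).add
    (continuous_const.mul h2)

end Flux

section Mollification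

variable {E : Type*} [NormedAddCommGroup E] [InnerProductSpace ℝ E] [FiniteDimensional ℝ E]

theorem gradient_eq_zero_of_notMem_tsupport {φ : E → ℝ} {x : E} (hx : x ∉ tsupport φ) :
    gradient φ x = 0 := by
  rw [gradient, fderiv_of_notMem_tsupport ℝ hx, map_zero]

theorem ContDiffOn.continuousOn_gradient {u : E → ℝ} {U : Set E} (hu : ContDiffOn ℝ 1 u U)
    (hU : IsOpen U) : ContinuousOn (gradient u) U :=
  (InnerProductSpace.toDual ℝ E).symm.continuous.comp_continuousOn
    (hu.continuousOn_fderiv_of_isOpen hU le_rfl)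

theorem gradient_comp_isometry (f : E → ℝ) (L : E ≃ₗᵢ[ℝ] E) (c x : E) :
    gradient (fun z => f (L z + c)) x = L.symm (gradient f (L x + c)) := by
  refine ext_inner_right ℝ fun w => ?_
  have h : fderiv ℝ (fun z => f (L z + c)) x
      = (fderiv ℝ f (L x + c)).comp (L.toContinuousLinearEquiv : E →L[ℝ] E) := by
    have := L.toContinuousLinearEquiv.comp_right_fderiv (f := fun z => f (z + c)) (x := x)
    rw [fderiv_comp_add_right] at this
    exact this
  rw [inner_gradient_left, h, ← L.inner_map_map, L.apply_symm_apply, inner_gradient_left]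
  rfl

variable [MeasurableSpace E] [BorelSpace E]

theorem integrable_of_continuousOn_of_eq_zero {U K : Set E} {f : E → ℝ} (hK : IsCompact K)
    (hKU : K ⊆ U) (hf : ContinuousOn f U) (h0 : ∀ x ∉ K, f x = 0) : Integrable f := by
  refine (integrableOn_iff_integrable_of_support_subset fun x hx => ?_).1
    ((hf.mono hKU).integrableOn_compact hK)
  by_contra h
  exact hx (h0 x h)

theorem abs_setIntegral_le_of_eq_zero_off {U K : Set E} {f F : E → ℝ} {η : ℝ} (hU : IsOpen U)
    (hK : IsCompact K) (hKU : K ⊆ U) (hF : ContinuousOn F U) (h0 : ∀ x ∉ K, f x = 0)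
    (hfF : ∀ x, |f x| ≤ F x * η) : |∫ x in U, f x| ≤ (∫ x in K, F x) * η := by
  rw [setIntegral_eq_of_subset_of_forall_sdiff_eq_zero hU.measurableSet hKU
    fun x hx => h0 x hx.2, ← integral_mul_const, ← Real.norm_eq_abs]
  exact norm_integral_le_of_norm_le (((hF.mono hKU).integrableOn_compact hK).mul_const η)
    (Eventually.of_forall hfF)

theorem exists_smooth_approx {U : Set E} (hU : IsOpen U) {φ : E → ℝ} (hφ : ContDiff ℝ 1 φ)
    (hc : HasCompactSupport φ) (hs : tsupport φ ⊆ U) :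
    ∃ K, IsCompact K ∧ K ⊆ U ∧ tsupport φ ⊆ K ∧ ∀ η > 0, ∃ ψ : E → ℝ,
      ContDiff ℝ (⊤ : ℕ∞) ψ ∧ tsupport ψ ⊆ K ∧ (∀ x, |ψ x - φ x| ≤ η) ∧
        ∀ x, ‖gradient ψ x - gradient φ x‖ ≤ η := by
  obtain ⟨δ, hδ, hδU⟩ := hc.isCompact.exists_cthickening_subset_open hU hs
  refine ⟨cthickening δ (tsupport φ), hc.isCompact.cthickening, hδU,
    self_subset_cthickening _, fun η hη => ?_⟩
  have hfc : Continuous (fderiv ℝ φ) := hφ.continuous_fderiv one_ne_zero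
  have hu1 := hc.uniformContinuous_of_continuous hφ.continuous
  have hu2 := (hc.fderiv ℝ).uniformContinuous_of_continuous hfc
  obtain ⟨d1, hd1, h1⟩ := Metric.uniformContinuous_iff.1 hu1 η hη
  obtain ⟨d2, hd2, h2⟩ := Metric.uniformContinuous_iff.1 hu2 η hη
  set r := min δ (min d1 d2) with hr
  have hr0 : 0 < r := lt_min hδ (lt_min hd1 hd2)
  let ρ : ContDiffBump (0 : E) := ⟨r / 2, r, by positivity, by linarith⟩
  set ψ : E → ℝ := convolution (ρ.normed volume) φ (ContinuousLinearMap.lsmul ℝ ℝ) volume with hψ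
  have hρ : LocallyIntegrable (ρ.normed volume) volume :=
    (ρ.contDiff_normed (n := 0)).continuous.locallyIntegrable
  have hgrad : ∀ x, fderiv ℝ ψ x = convolution (ρ.normed volume) (fderiv ℝ φ)
      (ContinuousLinearMap.lsmul ℝ ℝ) volume x := fun x => by
    rw [(hc.hasFDerivAt_convolution_right (ContinuousLinearMap.lsmul ℝ ℝ) hρ hφ x).fderiv]
    congr 1
  have hdist : ∀ x, |ψ x - φ x| ≤ η := fun x =>
    ρ.dist_normed_convolution_le hφ.continuous.aestronglyMeasurable fun z hz =>
      (h1 (lt_of_lt_of_le hz ((min_le_right _ _).trans (min_le_left _ _)))).le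
  have hdist' : ∀ x, ‖gradient ψ x - gradient φ x‖ ≤ η := fun x => by
    rw [gradient, gradient, ← map_sub, LinearIsometryEquiv.norm_map, hgrad, ← dist_eq_norm]
    exact ρ.dist_normed_convolution_le hfc.aestronglyMeasurable fun z hz =>
      (h2 (lt_of_lt_of_le hz ((min_le_right _ _).trans (min_le_right _ _)))).le
  refine ⟨ψ, ρ.hasCompactSupport_normed.contDiff_convolution_left _ ρ.contDiff_normed
    hφ.continuous.locallyIntegrable, closure_minimal (fun x hx => ?_) isClosed_cthickening,
    hdist, hdist'⟩
  by_contra hxK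
  have hz : ∀ z ∈ ball x r, φ z = 0 := fun z hz => by
    by_contra hzφ
    refine hxK (mem_cthickening_of_dist_le x z δ _ (subset_tsupport φ hzφ) ?_)
    rw [dist_comm]
    exact (lt_of_lt_of_le hz (min_le_left _ _)).le
  have hx0 := hz x (mem_ball_self hr0)
  have := ρ.dist_normed_convolution_le (μ := volume) (x₀ := x) (ε := 0)
    hφ.continuous.aestronglyMeasurable fun z hzb => by
    rw [hz z hzb, hx0, dist_self]
  rw [hx0] at this
  exact hx (dist_le_zero.1 this)

end Mollification

/-- The weak formulation of `-Δ_p u = h` in `U` tested against compactly supported `C^1`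
functions. -/
def IsC1WeakSolution (p : ℝ) {N : ℕ} (U : Set (EuclideanSpace ℝ (Fin N)))
    (u h : EuclideanSpace ℝ (Fin N) → ℝ) : Prop :=
  ∀ φ : EuclideanSpace ℝ (Fin N) → ℝ, ContDiff ℝ 1 φ → HasCompactSupport φ → tsupport φ ⊆ U →
    ∫ x in U, ⟪pFlux p (gradient u x), gradient φ x⟫ = ∫ x in U, h x * φ x

section Weak

variable {N : ℕ} {p : ℝ} {U : Set (EuclideanSpace ℝ (Fin N))}
  {u h φ : EuclideanSpace ℝ (Fin N) → ℝ}

theorem integrable_inner_pFlux_gradient (hp : 1 < p) (hU : IsOpen U) (hu : ContDiffOn ℝ 1 u U)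
    (hφ : ContDiff ℝ 1 φ) (hc : HasCompactSupport φ) (hs : tsupport φ ⊆ U) :
    Integrable fun x => ⟪pFlux p (gradient u x), gradient φ x⟫ :=
  integrable_of_continuousOn_of_eq_zero hc.isCompact hs
    (((continuous_pFlux hp).comp_continuousOn (hu.continuousOn_gradient hU)).inner
      (hφ.contDiffOn.continuousOn_gradient isOpen_univ |>.mono (subset_univ _)))
    fun x hx => by rw [gradient_eq_zero_of_notMem_tsupport hx, inner_zero_right]

theorem integrable_mul_of_tsupport_subset (hh : ContinuousOn h U)
    (hφ : ContDiff ℝ 1 φ) (hc : HasCompactSupport φ) (hs : tsupport φ ⊆ U) :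
    Integrable fun x => h x * φ x :=
  integrable_of_continuousOn_of_eq_zero hc.isCompact hs (hh.mul hφ.continuous.continuousOn)
    fun x hx => by rw [image_eq_zero_of_notMem_tsupport hx, mul_zero]

theorem IsWeakSolution.isC1WeakSolution (hp : 1 < p) (hU : IsOpen U) (hu : ContDiffOn ℝ 1 u U)
    (hh : ContinuousOn h U) (hw : IsWeakSolution p U u h) : IsC1WeakSolution p U u h := by
  intro φ hφ hc hs
  obtain ⟨K, hK, hKU, hφK, happ⟩ := exists_smooth_approx hU hφ hc hs
  have hF : ContinuousOn (fun x => ‖pFlux p (gradient u x)‖) U :=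
    ((continuous_pFlux hp).comp_continuousOn (hu.continuousOn_gradient hU)).norm
  set C := (∫ x in K, ‖pFlux p (gradient u x)‖) + ∫ x in K, |h x| with hC
  have key : ∀ η > 0, |(∫ x in U, ⟪pFlux p (gradient u x), gradient φ x⟫)
      - ∫ x in U, h x * φ x| ≤ C * η := by
    intro η hη
    obtain ⟨ψ, hψ, hψK, h1, h2⟩ := happ η hη
    have hψc : HasCompactSupport ψ := hK.of_isClosed_subset isClosed_closure hψK
    have hψ1 : ContDiff ℝ 1 ψ := hψ.of_le (by exact_mod_cast le_top)
    have hψU := hψK.trans hKU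
    have hweak := hw ψ ⟨hψ, hψc, hψU⟩
    simp_rw [← real_inner_smul_left] at hweak
    change (∫ x in U, ⟪pFlux p (gradient u x), gradient ψ x⟫) = _ at hweak
    have e1 : |∫ x in U, (⟪pFlux p (gradient u x), gradient ψ x⟫
        - ⟪pFlux p (gradient u x), gradient φ x⟫)|
        ≤ (∫ x in K, ‖pFlux p (gradient u x)‖) * η := by
      refine abs_setIntegral_le_of_eq_zero_off hU hK hKU hF (fun x hx => ?_) fun x => ?_
      · rw [gradient_eq_zero_of_notMem_tsupport fun h => hx (hψK h),
          gradient_eq_zero_of_notMem_tsupport fun h => hx (hφK h), sub_self]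
      · rw [← inner_sub_right]
        exact (abs_real_inner_le_norm _ _).trans
          (mul_le_mul_of_nonneg_left (h2 x) (norm_nonneg _))
    have e2 : |∫ x in U, (h x * ψ x - h x * φ x)| ≤ (∫ x in K, |h x|) * η := by
      refine abs_setIntegral_le_of_eq_zero_off hU hK hKU hh.abs (fun x hx => ?_) fun x => ?_
      · rw [image_eq_zero_of_notMem_tsupport fun h => hx (hψK h),
          image_eq_zero_of_notMem_tsupport fun h => hx (hφK h), sub_self]
      · rw [← mul_sub, abs_mul]
        exact mul_le_mul_of_nonneg_left (h1 x) (abs_nonneg _)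
    rw [integral_sub (integrable_inner_pFlux_gradient hp hU hu hψ1 hψc hψU).integrableOn
      (integrable_inner_pFlux_gradient hp hU hu hφ hc hs).integrableOn, hweak] at e1
    rw [integral_sub (integrable_mul_of_tsupport_subset hh hψ1 hψc hψU).integrableOn
      (integrable_mul_of_tsupport_subset hh hφ hc hs).integrableOn] at e2
    rw [hC, add_mul]
    rw [abs_le] at e1 e2 ⊢
    constructor <;> linarith [e1.1, e1.2, e2.1, e2.2]
  have hlim : Tendsto (fun η : ℝ => C * η) (𝓝[>] 0) (𝓝 0) := by
    have : Tendsto (fun η : ℝ => C * η) (𝓝 0) (𝓝 (C * 0)) := tendsto_const_nhds.mul tendsto_id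
    rw [mul_zero] at this
    exact this.mono_left nhdsWithin_le_nhds
  have h0 := ge_of_tendsto hlim (eventually_nhdsWithin_of_forall key)
  exact sub_eq_zero.1 (abs_eq_zero.1 (le_antisymm h0 (abs_nonneg _)))

theorem IsC1WeakSolution.comp_isometry {O : Set (EuclideanSpace ℝ (Fin N))}
    (hw : IsC1WeakSolution p U u h)
    (L : EuclideanSpace ℝ (Fin N) ≃ₗᵢ[ℝ] EuclideanSpace ℝ (Fin N)) (c : EuclideanSpace ℝ (Fin N))
    (hO : ∀ x ∈ O, L x + c ∈ U) :
    IsC1WeakSolution p O (fun x => u (L x + c)) (fun x => h (L x + c)) := by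
  intro φ hφ hc hs
  set ψ : EuclideanSpace ℝ (Fin N) → ℝ := fun z => φ (L.symm (z - c)) with hψ
  have hφψ : φ = fun x => ψ (L x + c) := by
    ext x
    simp [hψ]
  have hR : Continuous fun x => L x + c := L.continuous.add continuous_const
  have hKc : IsCompact ((fun x => L x + c) '' tsupport φ) := hc.isCompact.image hR
  have hsub : tsupport ψ ⊆ (fun x => L x + c) '' tsupport φ := by
    refine closure_minimal (fun z hz => ⟨L.symm (z - c), subset_tsupport φ hz, ?_⟩)
      hKc.isClosed
    simp
  have hψU : tsupport ψ ⊆ U := hsub.trans (by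
    rintro _ ⟨x, hx, rfl⟩
    exact hO x (hs hx))
  have hψ1 : ContDiff ℝ 1 ψ :=
    hφ.comp (L.symm.toContinuousLinearEquiv.contDiff.comp (contDiff_id.sub contDiff_const))
  have hmain := hw ψ hψ1 (hKc.of_isClosed_subset isClosed_closure hsub) hψU
  have change (G : EuclideanSpace ℝ (Fin N) → ℝ) : ∫ x, G (L x + c) = ∫ x, G x := by
    rw [L.measurePreserving.integral_comp L.toHomeomorph.measurableEmbedding (fun z => G (z + c)),
      integral_add_right_eq_self]
  rw [setIntegral_eq_integral_of_forall_compl_eq_zero fun x hx => by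
      rw [gradient_eq_zero_of_notMem_tsupport fun h => hx (hψU h), inner_zero_right],
    setIntegral_eq_integral_of_forall_compl_eq_zero fun x hx => by
      rw [image_eq_zero_of_notMem_tsupport fun h => hx (hψU h), mul_zero],
    ← change, ← change fun x => h x * ψ x] at hmain
  rw [setIntegral_eq_integral_of_forall_compl_eq_zero fun x hx => by
      rw [gradient_eq_zero_of_notMem_tsupport fun h => hx (hs h), inner_zero_right],
    setIntegral_eq_integral_of_forall_compl_eq_zero fun x hx => by
      rw [image_eq_zero_of_notMem_tsupport fun h => hx (hs h), mul_zero]]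
  convert hmain using 2
  · ext x
    rw [hφψ, gradient_comp_isometry, gradient_comp_isometry, pFlux, pFlux,
      LinearIsometryEquiv.norm_map, real_inner_smul_left, real_inner_smul_left,
      LinearIsometryEquiv.inner_map_map]
  · ext x
    rw [hφψ]

end Weak

section Comparison

variable {N : ℕ} {p : ℝ} {O : Set (EuclideanSpace ℝ (Fin N))}
  {u v : EuclideanSpace ℝ (Fin N) → ℝ}

/-- The logarithmic ratio `log (u / (v + ε))`. -/
def logRatio {X : Type*} (u v : X → ℝ) (ε : ℝ) (x : X) : ℝ :=
  Real.log (u x) - Real.log (v x + ε)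

theorem logRatio_nonpos {X : Type*} {u v : X → ℝ} {ε : ℝ} {x : X} (hu : 0 < u x)
    (h : u x ≤ v x + ε) : logRatio u v ε x ≤ 0 :=
  sub_nonpos.2 (Real.log_le_log hu h)

theorem indicator_isTestFunction (hO : IsOpen O) (hcpt : IsCompact (closure O))
    (hu : ContinuousOn u (closure O)) (hv : ContinuousOn v (closure O))
    (hfr : ∀ x ∈ frontier O, u x ≤ v x) {ε : ℝ} (hε : 0 < ε) {F : EuclideanSpace ℝ (Fin N) → ℝ}
    (hF : ContDiffOn ℝ 1 F O) (h0 : ∀ x ∈ O, u x ≤ v x + ε → F x = 0) :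
    ContDiff ℝ 1 (O.indicator F) ∧ HasCompactSupport (O.indicator F) ∧
      tsupport (O.indicator F) ⊆ O := by
  set K := closure O ∩ (fun x => u x - v x) ⁻¹' Ici ε with hK
  have hKclosed : IsClosed K :=
    (hu.sub hv).preimage_isClosed_of_isClosed isClosed_closure isClosed_Ici
  have hKO : K ⊆ O := fun x hx => by
    by_contra hxO
    have := hfr x (hO.frontier_eq ▸ ⟨hx.1, hxO⟩)
    have h2 : ε ≤ u x - v x := hx.2
    linarith
  have hsub : tsupport (O.indicator F) ⊆ K := by
    refine closure_minimal (fun x hx => ?_) hKclosed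
    have hxO : x ∈ O := by
      by_contra h
      exact hx (indicator_of_notMem h F)
    refine ⟨subset_closure hxO, ?_⟩
    by_contra h
    have h' : u x - v x < ε := not_le.1 h
    exact hx (by rw [indicator_of_mem hxO, h0 x hxO (by linarith)])
  refine ⟨contDiff_iff_contDiffAt.2 fun x => ?_,
    hcpt.of_isClosed_subset isClosed_closure (hsub.trans inter_subset_left), hsub.trans hKO⟩
  by_cases hx : x ∈ tsupport (O.indicator F)
  · have hxO := hO.mem_nhds (hKO (hsub hx))
    refine (hF.contDiffAt hxO).congr_of_eventuallyEq ?_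
    filter_upwards [hxO] with y hy using indicator_of_mem hy F
  · exact contDiffAt_const.congr_of_eventuallyEq (notMem_tsupport_iff_eventuallyEq.1 hx)

theorem gradient_indicator (hO : IsOpen O) {F : EuclideanSpace ℝ (Fin N) → ℝ}
    {x : EuclideanSpace ℝ (Fin N)} (hx : x ∈ O) : gradient (O.indicator F) x = gradient F x := by
  refine Filter.EventuallyEq.gradient_eq ?_
  filter_upwards [hO.mem_nhds hx] with y hy using indicator_of_mem hy F

/-- The integrand in the generalized Picone identity for `u` and `v + ε`. -/
def piconeIntegrand (p : ℝ) (u v : EuclideanSpace ℝ (Fin N) → ℝ) (ε : ℝ)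
    (x : EuclideanSpace ℝ (Fin N)) : ℝ :=
  u x ^ p * (Real.smoothTransition (logRatio u v ε x) *
      convexityGap p ((u x)⁻¹ • gradient u x) ((v x + ε)⁻¹ • gradient v x) +
    deriv Real.smoothTransition (logRatio u v ε x) *
      ⟪pFlux p ((u x)⁻¹ • gradient u x) - pFlux p ((v x + ε)⁻¹ • gradient v x),
        (u x)⁻¹ • gradient u x - (v x + ε)⁻¹ • gradient v x⟫)

theorem piconeIntegrand_ge (hp : 1 < p) {ε : ℝ} {x : EuclideanSpace ℝ (Fin N)} (hu : 0 < u x) :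
    u x ^ p * (Real.smoothTransition (logRatio u v ε x) *
      convexityGap p ((u x)⁻¹ • gradient u x) ((v x + ε)⁻¹ • gradient v x)) ≤
      piconeIntegrand p u v ε x := by
  refine mul_le_mul_of_nonneg_left ?_ (Real.rpow_nonneg hu.le _)
  exact le_add_of_nonneg_right
    (mul_nonneg Real.smoothTransition.monotone.deriv_nonneg (inner_pFlux_sub_nonneg hp _ _))

theorem picone_identity (hp : 1 < p) {ε : ℝ} {x : EuclideanSpace ℝ (Fin N)}
    (hu : DifferentiableAt ℝ u x) (hv : DifferentiableAt ℝ v x) (hux : 0 < u x)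
    (hvx : 0 < v x + ε) :
    ⟪pFlux p (gradient u x),
        gradient (fun z => u z * Real.smoothTransition (logRatio u v ε z)) x⟫ -
      ⟪pFlux p (gradient v x), gradient (fun z => u z ^ p * (v z + ε) ^ (1 - p) *
        Real.smoothTransition (logRatio u v ε z)) x⟫ = piconeIntegrand p u v ε x := by
  have hg : DifferentiableAt ℝ Real.smoothTransition (logRatio u v ε x) :=
    (Real.smoothTransition.contDiffAt (n := 1)).differentiableAt one_ne_zero
  have hv' : HasFDerivAt (fun z => v z + ε) (fderiv ℝ v x) x := hv.hasFDerivAt.add_const ε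
  have hw : HasFDerivAt (logRatio u v ε)
      ((u x)⁻¹ • fderiv ℝ u x - (v x + ε)⁻¹ • fderiv ℝ v x) x :=
    (hu.hasFDerivAt.log hux.ne').sub (hv'.log hvx.ne')
  have hgw : HasFDerivAt (fun z => Real.smoothTransition (logRatio u v ε z))
      (deriv Real.smoothTransition (logRatio u v ε x) •
        ((u x)⁻¹ • fderiv ℝ u x - (v x + ε)⁻¹ • fderiv ℝ v x)) x :=
    hg.hasDerivAt.comp_hasFDerivAt x hw
  have h1 := hu.hasFDerivAt.fun_mul hgw
  have h2 := ((hu.hasFDerivAt.rpow_const (p := p) (Or.inl hux.ne')).fun_mul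
    (hv'.rpow_const (p := 1 - p) (Or.inl hvx.ne'))).fun_mul hgw
  rw [inner_gradient_right, inner_gradient_right, conj_trivial, conj_trivial, h1.fderiv, h2.fderiv]
  simp only [add_apply, smul_apply,
    sub_apply, ← inner_gradient_left, smul_eq_mul]
  rw [piconeIntegrand]
  set g := Real.smoothTransition (logRatio u v ε x)
  set g' := deriv Real.smoothTransition (logRatio u v ε x)
  set V := v x + ε
  set U := u x
  obtain ⟨a, ha⟩ : ∃ a, a = U⁻¹ • gradient u x := ⟨_, rfl⟩
  obtain ⟨b, hb⟩ : ∃ b, b = V⁻¹ • gradient v x := ⟨_, rfl⟩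
  have ha' : gradient u x = U • a := by rw [ha, smul_inv_smul₀ hux.ne']
  have hb' : gradient v x = V • b := by rw [hb, smul_inv_smul₀ hvx.ne']
  rw [← ha, ← hb, ha', hb', pFlux_smul hux, pFlux_smul hvx, convexityGap]
  simp only [real_inner_smul_left, real_inner_smul_right, inner_sub_left, inner_sub_right,
    inner_pFlux_self hp, real_inner_comm (pFlux p a) a, real_inner_comm (pFlux p b) b,
    real_inner_comm (pFlux p a) b, real_inner_comm (pFlux p b) a]
  have hU : U ^ (p - 1) = U ^ p / U := Real.rpow_sub_one hux.ne' p
  have hV : V ^ (p - 1) = V ^ p / V := Real.rpow_sub_one hvx.ne' p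
  have hV1 : V ^ (1 - p) = V / V ^ p := by rw [Real.rpow_sub hvx, Real.rpow_one]
  have hV2 : V ^ (1 - p - 1) = 1 / V ^ p := by
    rw [show 1 - p - 1 = -p by ring, Real.rpow_neg hvx.le, one_div]
  have hVp : V ^ p ≠ 0 := (Real.rpow_pos_of_pos hvx p).ne'
  have hU0 := hux.ne'
  have hV0 := hvx.ne'
  rw [hU, hV, hV1, hV2]
  field_simp
  ring

theorem integral_piconeIntegrand (hp : 1 < p) {lam : ℝ} (hO : IsOpen O)
    (hcpt : IsCompact (closure O))
    (hu : ContinuousOn u (closure O)) (hv : ContinuousOn v (closure O))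
    (hu1 : ContDiffOn ℝ 1 u O) (hv1 : ContDiffOn ℝ 1 v O)
    (hupos : ∀ x ∈ O, 0 < u x) (hvpos : ∀ x ∈ O, 0 < v x)
    (hfr : ∀ x ∈ frontier O, u x ≤ v x)
    (hwu : IsC1WeakSolution p O u fun x => lam * u x ^ (p - 1))
    (hwv : IsC1WeakSolution p O v fun x => lam * v x ^ (p - 1)) {ε : ℝ} (hε : 0 < ε) :
    IntegrableOn (piconeIntegrand p u v ε) O ∧
      ∫ x in O, piconeIntegrand p u v ε x =
        lam * ∫ x in O, u x ^ p * (Real.smoothTransition (logRatio u v ε x) *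
          (1 - v x ^ (p - 1) * (v x + ε) ^ (1 - p))) := by
  have hVpos : ∀ x ∈ O, 0 < v x + ε := fun x hx => add_pos (hvpos x hx) hε
  have hV1 : ContDiffOn ℝ 1 (fun x => v x + ε) O := hv1.add contDiffOn_const
  have hg1 : ContDiffOn ℝ 1 (fun x => Real.smoothTransition (logRatio u v ε x)) O :=
    (Real.smoothTransition.contDiff (n := 1)).comp_contDiffOn
      ((hu1.log fun x hx => (hupos x hx).ne').sub (hV1.log fun x hx => (hVpos x hx).ne'))
  have hg0 : ∀ x ∈ O, u x ≤ v x + ε → Real.smoothTransition (logRatio u v ε x) = 0 :=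
    fun x hx h => Real.smoothTransition.zero_of_nonpos (logRatio_nonpos (hupos x hx) h)
  obtain ⟨hφ, hφc, hφs⟩ := indicator_isTestFunction hO hcpt hu hv hfr hε (hu1.mul hg1)
    fun x hx h => by simp [hg0 x hx h]
  obtain ⟨hψ, hψc, hψs⟩ := indicator_isTestFunction hO hcpt hu hv hfr hε
    (((hu1.rpow_const_of_ne (p := p) fun x hx => (hupos x hx).ne').mul
      (hV1.rpow_const_of_ne (p := 1 - p) fun x hx => (hVpos x hx).ne')).mul hg1)
    fun x hx h => by simp [hg0 x hx h]
  have hupc : ContinuousOn (fun x => lam * u x ^ (p - 1)) O :=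
    continuousOn_const.mul (hu1.continuousOn.rpow_const fun x hx => Or.inl (hupos x hx).ne')
  have hvpc : ContinuousOn (fun x => lam * v x ^ (p - 1)) O :=
    continuousOn_const.mul (hv1.continuousOn.rpow_const fun x hx => Or.inl (hvpos x hx).ne')
  have iu := (integrable_inner_pFlux_gradient hp hO hu1 hφ hφc hφs).integrableOn (s := O)
  have iv := (integrable_inner_pFlux_gradient hp hO hv1 hψ hψc hψs).integrableOn (s := O)
  have ju := (integrable_mul_of_tsupport_subset hupc hφ hφc hφs).integrableOn (s := O)
  have jv := (integrable_mul_of_tsupport_subset hvpc hψ hψc hψs).integrableOn (s := O)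
  have hEq : EqOn (fun x => ⟪pFlux p (gradient u x), gradient (O.indicator
        fun z => u z * Real.smoothTransition (logRatio u v ε z)) x⟫ -
      ⟪pFlux p (gradient v x), gradient (O.indicator fun z => u z ^ p * (v z + ε) ^ (1 - p) *
        Real.smoothTransition (logRatio u v ε z)) x⟫)
      (piconeIntegrand p u v ε) O := fun x hx => by
    have := picone_identity (ε := ε) hp
      ((hu1.differentiableOn one_ne_zero).differentiableAt (hO.mem_nhds hx))
      ((hv1.differentiableOn one_ne_zero).differentiableAt (hO.mem_nhds hx))
      (hupos x hx) (hVpos x hx)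
    dsimp only
    rw [gradient_indicator hO hx, gradient_indicator hO hx, this]
  refine ⟨(integrableOn_congr_fun hEq hO.measurableSet).1 (iu.sub iv), ?_⟩
  rw [← setIntegral_congr_fun hO.measurableSet hEq, integral_sub iu iv, hwu _ hφ hφc hφs,
    hwv _ hψ hψc hψs, ← integral_sub ju jv, ← integral_const_mul]
  refine setIntegral_congr_fun hO.measurableSet fun x hx => ?_
  have hU : u x ^ p = u x ^ (p - 1) * u x := by
    rw [← Real.rpow_add_one (hupos x hx).ne', sub_add_cancel]
  simp only [indicator_of_mem hx, hU]
  ring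

theorem tendsto_integral_comparison (hp : 1 < p) (hO : IsOpen O)
    (hcpt : IsCompact (closure O)) (hu : ContinuousOn u (closure O))
    (hv : ContinuousOn v (closure O))
    (hupos : ∀ x ∈ O, 0 < u x) (hvpos : ∀ x ∈ O, 0 < v x) :
    Tendsto (fun ε => ∫ x in O, u x ^ p * (Real.smoothTransition (logRatio u v ε x) *
      (1 - v x ^ (p - 1) * (v x + ε) ^ (1 - p)))) (𝓝[>] 0) (𝓝 0) := by
  obtain ⟨M, hM⟩ := hcpt.exists_bound_of_continuousOn
    (hu.rpow_const (p := p) fun x _ => Or.inr (by linarith))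
  have hfin : volume O < ⊤ := (measure_mono subset_closure).trans_lt hcpt.measure_lt_top
  have hbd : ∀ ε > 0, ∀ x ∈ O, ‖u x ^ p * (Real.smoothTransition (logRatio u v ε x) *
      (1 - v x ^ (p - 1) * (v x + ε) ^ (1 - p)))‖ ≤
        M * (1 - v x ^ (p - 1) * (v x + ε) ^ (1 - p)) ∧
      0 ≤ v x ^ (p - 1) * (v x + ε) ^ (1 - p) ∧ 0 ≤ M := by
    intro ε hε x hx
    have hvx := hvpos x hx
    have hVx : 0 < v x + ε := by linarith
    have hq : v x ^ (p - 1) * (v x + ε) ^ (1 - p) ≤ 1 := by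
      rw [show 1 - p = -(p - 1) by ring, Real.rpow_neg hVx.le, ← div_eq_mul_inv,
        div_le_one (by positivity)]
      exact Real.rpow_le_rpow hvx.le (by linarith) (by linarith)
    have hMx := hM x (subset_closure hx)
    have hM0 : 0 ≤ M := (norm_nonneg _).trans hMx
    refine ⟨?_, by positivity, hM0⟩
    rw [norm_mul, norm_mul, Real.norm_of_nonneg (Real.smoothTransition.nonneg _),
      Real.norm_of_nonneg (sub_nonneg.2 hq)]
    refine mul_le_mul hMx ?_ (mul_nonneg (Real.smoothTransition.nonneg _) (sub_nonneg.2 hq)) hM0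
    exact mul_le_of_le_one_left (sub_nonneg.2 hq) (Real.smoothTransition.le_one _)
  suffices h : Tendsto (fun ε => ∫ x in O, u x ^ p *
      (Real.smoothTransition (logRatio u v ε x) * (1 - v x ^ (p - 1) * (v x + ε) ^ (1 - p))))
      (𝓝[>] 0) (𝓝 (∫ _ in O, (0 : ℝ))) by
    rwa [integral_zero] at h
  refine tendsto_integral_filter_of_dominated_convergence (fun _ => M) ?_ ?_
    (integrableOn_const hfin.ne) ?_
  · filter_upwards [self_mem_nhdsWithin] with ε hε
    have hV : ∀ x ∈ O, v x + ε ≠ 0 := fun x hx => (add_pos (hvpos x hx) hε).ne'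
    have huO := hu.mono subset_closure
    have hvO := hv.mono subset_closure
    have hVc : ContinuousOn (fun x => v x + ε) O := hvO.add continuousOn_const
    refine ContinuousOn.aestronglyMeasurable ?_ hO.measurableSet
    refine (huO.rpow_const fun x hx => Or.inl (hupos x hx).ne').mul
      ((Real.smoothTransition.continuous.comp_continuousOn
        ((huO.log fun x hx => (hupos x hx).ne').sub (hVc.log hV))).mul
      (continuousOn_const.sub ((hvO.rpow_const fun x hx => Or.inl (hvpos x hx).ne').mul
        (hVc.rpow_const fun x hx => Or.inl (hV x hx)))))
  · filter_upwards [self_mem_nhdsWithin] with ε hε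
    filter_upwards [ae_restrict_mem hO.measurableSet] with x hx
    obtain ⟨h1, h2, h3⟩ := hbd ε hε x hx
    nlinarith
  · filter_upwards [ae_restrict_mem hO.measurableSet] with x hx
    have hvx := hvpos x hx
    refine squeeze_zero_norm' (a := fun ε => M * (1 - v x ^ (p - 1) * (v x + ε) ^ (1 - p))) ?_ ?_
    · filter_upwards [self_mem_nhdsWithin] with ε hε using (hbd ε hε x hx).1
    · refine Tendsto.mono_left ?_ nhdsWithin_le_nhds
      have hc : ContinuousAt (fun ε => M * (1 - v x ^ (p - 1) * (v x + ε) ^ (1 - p))) 0 :=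
        continuousAt_const.mul (continuousAt_const.sub (continuousAt_const.mul
          ((continuousAt_const.add continuousAt_id).rpow_const (Or.inl (by simpa using hvx.ne')))))
      have h0 : M * (1 - v x ^ (p - 1) * (v x + 0) ^ (1 - p)) = 0 := by
        rw [add_zero, ← Real.rpow_add hvx]
        simp
      rw [ContinuousAt, h0] at hc
      exact hc

theorem continuousAt_weighted_convexityGap (hp : 1 < p) (hO : IsOpen O)
    (hu1 : ContDiffOn ℝ 1 u O) (hv1 : ContDiffOn ℝ 1 v O) {x₀ : EuclideanSpace ℝ (Fin N)}
    (hx₀ : x₀ ∈ O) (hu0 : 0 < u x₀) (hv0 : 0 < v x₀) :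
    ContinuousAt (fun z : ℝ × EuclideanSpace ℝ (Fin N) =>
      u z.2 ^ p * (Real.smoothTransition (logRatio u v z.1 z.2) *
        convexityGap p ((u z.2)⁻¹ • gradient u z.2) ((v z.2 + z.1)⁻¹ • gradient v z.2)))
      (0, x₀) := by
  have hsnd {Y : Type} [TopologicalSpace Y] {f : EuclideanSpace ℝ (Fin N) → Y}
      (hf : ContinuousOn f O) :
      ContinuousAt (fun z : ℝ × EuclideanSpace ℝ (Fin N) => f z.2) (0, x₀) :=
    ContinuousAt.comp (f := Prod.snd) (x := ((0 : ℝ), x₀))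
      (hf.continuousAt (hO.mem_nhds hx₀)) continuousAt_snd
  have cu := hsnd hu1.continuousOn
  have cgu := hsnd (hu1.continuousOn_gradient hO)
  have cgv := hsnd (hv1.continuousOn_gradient hO)
  have cV : ContinuousAt (fun z : ℝ × EuclideanSpace ℝ (Fin N) => v z.2 + z.1) (0, x₀) :=
    (hsnd hv1.continuousOn).add continuousAt_fst
  have hV0 : v x₀ + 0 ≠ 0 := by simpa using hv0.ne'
  have cl : ContinuousAt (fun z : ℝ × EuclideanSpace ℝ (Fin N) => logRatio u v z.1 z.2) (0, x₀) :=
    (cu.log hu0.ne').sub (cV.log hV0)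
  have cg : ContinuousAt (fun z : ℝ × EuclideanSpace ℝ (Fin N) =>
      convexityGap p ((u z.2)⁻¹ • gradient u z.2) ((v z.2 + z.1)⁻¹ • gradient v z.2)) (0, x₀) :=
    (continuous_convexityGap hp).continuousAt.comp₂ ((cu.inv₀ hu0.ne').smul cgu)
      ((cV.inv₀ hV0).smul cgv)
  have cs : ContinuousAt (fun z : ℝ × EuclideanSpace ℝ (Fin N) =>
      Real.smoothTransition (logRatio u v z.1 z.2)) (0, x₀) :=
    Real.smoothTransition.continuous.continuousAt.comp' cl
  exact (cu.rpow_const (Or.inl hu0.ne')).mul (cs.mul cg)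

/-- Wherever `u > v`, two positive solutions of the eigenvalue equation with `u ≤ v` on the
boundary have the same logarithmic gradient. -/
theorem logGradient_eq_of_lt (hp : 1 < p) {lam : ℝ} (hO : IsOpen O)
    (hcpt : IsCompact (closure O))
    (hu : ContinuousOn u (closure O)) (hv : ContinuousOn v (closure O))
    (hu1 : ContDiffOn ℝ 1 u O) (hv1 : ContDiffOn ℝ 1 v O)
    (hupos : ∀ x ∈ O, 0 < u x) (hvpos : ∀ x ∈ O, 0 < v x)
    (hfr : ∀ x ∈ frontier O, u x ≤ v x)
    (hwu : IsC1WeakSolution p O u fun x => lam * u x ^ (p - 1))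
    (hwv : IsC1WeakSolution p O v fun x => lam * v x ^ (p - 1))
    {x₀ : EuclideanSpace ℝ (Fin N)} (hx₀ : x₀ ∈ O) (hlt : v x₀ < u x₀) :
    (u x₀)⁻¹ • gradient u x₀ = (v x₀)⁻¹ • gradient v x₀ := by
  by_contra hne
  let B : ℝ × EuclideanSpace ℝ (Fin N) → ℝ := fun z =>
    u z.2 ^ p * (Real.smoothTransition (logRatio u v z.1 z.2) *
      convexityGap p ((u z.2)⁻¹ • gradient u z.2) ((v z.2 + z.1)⁻¹ • gradient v z.2))
  have hu0 := hupos x₀ hx₀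
  have hv0 := hvpos x₀ hx₀
  have hB0 : 0 < B (0, x₀) := by
    have h1 : 0 < convexityGap p ((u x₀)⁻¹ • gradient u x₀) ((v x₀ + 0)⁻¹ • gradient v x₀) := by
      rw [add_zero]
      exact convexityGap_pos hp hne
    have h2 : 0 < logRatio u v 0 x₀ := by
      rw [logRatio, add_zero]
      exact sub_pos.2 (Real.log_lt_log hv0 hlt)
    exact mul_pos (Real.rpow_pos_of_pos hu0 _) (mul_pos (Real.smoothTransition.pos_of_pos h2) h1)
  have hBc : ContinuousAt B (0, x₀) :=
    continuousAt_weighted_convexityGap hp hO hu1 hv1 hx₀ hu0 hv0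
  have hev : ∀ᶠ z in 𝓝 ((0 : ℝ), x₀), B (0, x₀) / 2 < B z :=
    hBc.eventually (lt_mem_nhds (half_lt_self hB0))
  rw [nhds_prod_eq] at hev
  obtain ⟨P, hP, Q, hQ, hPQ⟩ := eventually_prod_iff.1 hev
  obtain ⟨S, hSsub, hSopen, hxS⟩ := _root_.mem_nhds_iff.1 (inter_mem hQ (hO.mem_nhds hx₀))
  have hSO : S ⊆ O := fun x hx => (hSsub hx).2
  have hfin : volume S ≠ ⊤ :=
    ((measure_mono (hSO.trans subset_closure)).trans_lt hcpt.measure_lt_top).ne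
  have hSpos : 0 < volume.real S :=
    ENNReal.toReal_pos (hSopen.measure_pos volume ⟨x₀, hxS⟩).ne' hfin
  have hlow : ∀ᶠ ε in 𝓝[>] (0 : ℝ), B (0, x₀) / 2 * volume.real S ≤
      lam * ∫ x in O, u x ^ p * (Real.smoothTransition (logRatio u v ε x) *
        (1 - v x ^ (p - 1) * (v x + ε) ^ (1 - p))) := by
    filter_upwards [self_mem_nhdsWithin, nhdsWithin_le_nhds hP] with ε hε hPε
    obtain ⟨hint, heq⟩ := integral_piconeIntegrand hp hO hcpt hu hv hu1 hv1 hupos hvpos hfr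
      hwu hwv hε
    rw [← heq]
    have hge : ∀ x ∈ O, B (ε, x) ≤ piconeIntegrand p u v ε x :=
      fun x hx => piconeIntegrand_ge hp (hupos x hx)
    have hnn : ∀ x ∈ O, 0 ≤ B (ε, x) := fun x hx =>
      mul_nonneg (Real.rpow_nonneg (hupos x hx).le _)
        (mul_nonneg (Real.smoothTransition.nonneg _) (convexityGap_nonneg hp _ _))
    calc B (0, x₀) / 2 * volume.real S = ∫ _ in S, B (0, x₀) / 2 := by
          rw [setIntegral_const, smul_eq_mul, mul_comm]
      _ ≤ ∫ x in S, piconeIntegrand p u v ε x :=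
          setIntegral_mono_on (integrableOn_const hfin) (hint.mono_set hSO) hSopen.measurableSet
            fun x hx => (hPQ hPε (hSsub hx).1).le.trans (hge x (hSO hx))
      _ ≤ ∫ x in O, piconeIntegrand p u v ε x := by
          refine setIntegral_mono_set hint ?_ hSO.eventuallyLE
          filter_upwards [ae_restrict_mem hO.measurableSet] with x hx
          exact (hnn x hx).trans (hge x hx)
  have hlim := (tendsto_integral_comparison hp hO hcpt hu hv hupos hvpos).const_mul lam
  rw [mul_zero] at hlim
  have := ge_of_tendsto hlim hlow
  have : 0 < B (0, x₀) / 2 * volume.real S := mul_pos (half_pos hB0) hSpos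
  linarith

end Comparison

section FirstCrossing

theorem exists_first_le {f : ℝ → ℝ} {a b c : ℝ} (hab : a ≤ b) (hf : ContinuousOn f (Icc a b))
    (hc : c ≤ f b) : ∃ t ∈ Icc a b, c ≤ f t ∧ ∀ r ∈ Ico a t, f r < c := by
  have hK : IsCompact (Icc a b ∩ f ⁻¹' Ici c) :=
    isCompact_Icc.of_isClosed_subset (hf.preimage_isClosed_of_isClosed isClosed_Icc isClosed_Ici)
      inter_subset_left
  obtain ⟨t, ht, hmin⟩ := hK.exists_isLeast ⟨b, right_mem_Icc.2 hab, hc⟩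
  refine ⟨t, ht.1, ht.2, fun r hr => ?_⟩
  by_contra! h
  exact absurd (hmin ⟨⟨hr.1, hr.2.le.trans ht.1.2⟩, h⟩) (not_le.2 hr.2)

/-- A continuous function that is stationary wherever it exceeds `c` never comes down to `c`. -/
theorem lt_of_hasDerivWithinAt_zero {q : ℝ → ℝ} {a b c : ℝ} (hab : a ≤ b)
    (hq : ContinuousOn q (Icc a b)) (ha : c < q a)
    (hd : ∀ t ∈ Ico a b, c < q t → HasDerivWithinAt q 0 (Ici t) t) : c < q b := by
  by_contra! hb
  obtain ⟨t, ht, hct, hlt⟩ := exists_first_le hab hq.neg (neg_le_neg hb)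
  have := constant_of_has_deriv_right_zero (hq.mono (Icc_subset_Icc_right ht.2))
    (fun r hr => hd r ⟨hr.1, hr.2.trans_le ht.2⟩ (neg_lt_neg_iff.1 (hlt r hr)))
    t (right_mem_Icc.2 ht.1)
  have := neg_le_neg_iff.1 hct
  linarith

end FirstCrossing

section Reflection

variable {N : ℕ} (hN : 2 ≤ N)

theorem norm_e1v : ‖e1v hN‖ = 1 := by
  simp [e1v]

theorem inner_e1v_left (x : EuclideanSpace ℝ (Fin N)) : ⟪e1v hN, x⟫ = x (firstIdx N hN) := by
  simp [e1v, EuclideanSpace.inner_single_left]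

theorem e1v_apply_firstIdx : e1v hN (firstIdx N hN) = 1 := by
  simp [e1v]

/-- The linear part of the reflection across `{x₁ = s}`. -/
def reflectLinear : EuclideanSpace ℝ (Fin N) ≃ₗᵢ[ℝ] EuclideanSpace ℝ (Fin N) :=
  (ℝ ∙ e1v hN)ᗮ.reflection

theorem reflectH_eq (s : ℝ) (x : EuclideanSpace ℝ (Fin N)) :
    reflectH hN s x = reflectLinear hN x + (2 * s) • e1v hN := by
  rw [reflectH, reflectLinear, Submodule.reflection_orthogonal_apply,
    Submodule.reflection_singleton_apply, norm_e1v, inner_e1v_left]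
  simp only [RCLike.ofReal_real_eq_id, id_eq]
  module

theorem norm_reflectH_sq (s : ℝ) (x : EuclideanSpace ℝ (Fin N)) :
    ‖reflectH hN s x‖ ^ 2 = ‖x‖ ^ 2 + 4 * s * (s - x (firstIdx N hN)) := by
  rw [reflectH, norm_add_sq_real, real_inner_comm, real_inner_smul_left, inner_e1v_left, norm_smul,
    norm_e1v, mul_one, Real.norm_eq_abs, sq_abs]
  ring

theorem norm_reflectH_sub (s : ℝ) (x : EuclideanSpace ℝ (Fin N)) :
    ‖reflectH hN s x - s • e1v hN‖ = ‖x - s • e1v hN‖ := by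
  rw [← sq_eq_sq₀ (norm_nonneg _) (norm_nonneg _), reflectH, add_sub_right_comm, norm_add_sq_real,
    real_inner_comm, real_inner_smul_left, inner_sub_right, inner_e1v_left, real_inner_smul_right,
    real_inner_self_eq_norm_sq, norm_smul, norm_e1v, Real.norm_eq_abs, mul_one, sq_abs]
  ring

theorem reflectH_of_apply_eq {s : ℝ} {x : EuclideanSpace ℝ (Fin N)}
    (hx : x (firstIdx N hN) = s) : reflectH hN s x = x := by
  simp [reflectH, hx]

theorem mem_annulus {r0 r1 s : ℝ} (hr0 : 0 < r0) {x : EuclideanSpace ℝ (Fin N)} :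
    x ∈ annulus hN r0 r1 s ↔ ‖x‖ < r1 ∧ r0 < ‖x - s • e1v hN‖ := by
  simp [annulus, closure_ball _ hr0.ne', dist_eq_norm]

theorem isOpen_annulus (r0 r1 s : ℝ) : IsOpen (annulus hN r0 r1 s) :=
  isOpen_ball.sdiff isClosed_closure

theorem reflectH_mem_annulus {r0 r1 s : ℝ} (hr0 : 0 < r0) (hs : 0 < s)
    {x : EuclideanSpace ℝ (Fin N)} (hx : s < x (firstIdx N hN)) (h1 : ‖x‖ ≤ r1)
    (h0 : r0 < ‖x - s • e1v hN‖) : reflectH hN s x ∈ annulus hN r0 r1 s := by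
  refine (mem_annulus hN hr0).2 ⟨lt_of_lt_of_le ?_ h1, by rwa [norm_reflectH_sub]⟩
  refine lt_of_pow_lt_pow_left₀ 2 (norm_nonneg _) ?_
  rw [norm_reflectH_sq]
  nlinarith [mul_pos hs (sub_pos.2 hx)]

end Reflection

theorem hasDerivAt_gradient_line {N : ℕ} {f : EuclideanSpace ℝ (Fin N) → ℝ}
    {a d : EuclideanSpace ℝ (Fin N)} {t : ℝ} (hf : DifferentiableAt ℝ f (a + t • d)) :
    HasDerivAt (fun r : ℝ => f (a + r • d)) ⟪gradient f (a + t • d), d⟫ t := by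
  have hl : HasDerivAt (fun r : ℝ => a + r • d) d t := by
    simpa using ((hasDerivAt_id t).smul_const d).const_add a
  exact (hf.hasGradientAt.hasFDerivAt.comp_hasDerivAt t hl).congr_deriv (by simp)

theorem hasDerivAt_div_line {N : ℕ} {u v : EuclideanSpace ℝ (Fin N) → ℝ}
    {a d : EuclideanSpace ℝ (Fin N)} {t : ℝ} (hu : DifferentiableAt ℝ u (a + t • d))
    (hv : DifferentiableAt ℝ v (a + t • d)) (hu0 : u (a + t • d) ≠ 0) (hv0 : v (a + t • d) ≠ 0)
    (h : (u (a + t • d))⁻¹ • gradient u (a + t • d) =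
      (v (a + t • d))⁻¹ • gradient v (a + t • d)) :
    HasDerivAt (fun r : ℝ => u (a + r • d) / v (a + r • d)) 0 t := by
  have h' := congrArg (fun w => ⟪w, d⟫) h
  simp only [real_inner_smul_left] at h'
  refine ((hasDerivAt_gradient_line hu).div (hasDerivAt_gradient_line hv) hv0).congr_deriv ?_
  field_simp at h' ⊢
  linarith

theorem eigenfunction_le_comp_reflectH {N : ℕ} (hN : 2 ≤ N) {p r0 r1 s : ℝ} (hp : 1 < p)
    (hr0 : 0 < r0) (hs : 0 < s) {y : EuclideanSpace ℝ (Fin N) → ℝ}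
    (hy : IsFirstEigenfun p (annulus hN r0 r1 s) y) {x₀ : EuclideanSpace ℝ (Fin N)}
    (hx₀ : x₀ ∈ annulus hN r0 r1 s) (hsx₀ : s < x₀ (firstIdx N hN)) :
    y x₀ ≤ y (reflectH hN s x₀) := by
  obtain ⟨⟨W, hWo, hΩW, hyW⟩, hypos, hyfr, -, hyw⟩ := hy
  set Ω := annulus hN r0 r1 s with hΩ
  set O := {x ∈ Ω | s < x (firstIdx N hN)} with hO
  have hΩo : IsOpen Ω := isOpen_annulus hN r0 r1 s
  have hcoord : Continuous fun x : EuclideanSpace ℝ (Fin N) => x (firstIdx N hN) := by fun_prop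
  have hOo : IsOpen O := hΩo.inter (isOpen_lt continuous_const hcoord)
  have hOΩ : O ⊆ Ω := fun x hx => hx.1
  have hclo : closure O ⊆ closure Ω := closure_mono hOΩ
  have hcpt : IsCompact (closure O) := by
    refine Bornology.IsBounded.isCompact_closure (isBounded_ball (x := 0) (r := r1) |>.subset ?_)
    exact hOΩ.trans sdiff_subset
  have hR : Continuous (reflectH hN s) := by unfold reflectH; fun_prop
  have hmaps : MapsTo (reflectH hN s) O Ω := fun x hx =>
    reflectH_mem_annulus hN hr0 hs hx.2 ((mem_annulus hN hr0).1 hx.1).1.le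
      ((mem_annulus hN hr0).1 hx.1).2
  have hmaps' : MapsTo (reflectH hN s) (closure O) (closure Ω) := hmaps.closure hR
  have hyc : ContinuousOn y (closure Ω) := hyW.continuousOn.mono hΩW
  have hy1 : ContDiffOn ℝ 1 y Ω := hyW.mono (subset_closure.trans hΩW)
  have hout : ∀ x ∈ closure Ω, x ∉ Ω → y x = 0 := fun x hx hx' =>
    hyfr x (hΩo.frontier_eq ▸ ⟨hx, hx'⟩)
  have hnn : ∀ x ∈ closure Ω, 0 ≤ y x := fun x hx => by
    by_cases h : x ∈ Ω
    · exact (hypos x h).le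
    · exact (hout x hx h).ge
  have hRfun : reflectH hN s = fun x => reflectLinear hN x + (2 * s) • e1v hN :=
    funext (reflectH_eq hN s)
  have hRd : ContDiff ℝ 1 (reflectH hN s) := by
    rw [hRfun]
    exact (reflectLinear hN).contDiff.add contDiff_const
  have hvc : ContinuousOn (fun x => y (reflectH hN s x)) (closure O) :=
    hyc.comp hR.continuousOn hmaps'
  have hv1 : ContDiffOn ℝ 1 (fun x => y (reflectH hN s x)) O := hy1.comp hRd.contDiffOn hmaps
  have hvpos : ∀ x ∈ O, 0 < y (reflectH hN s x) := fun x hx => hypos _ (hmaps hx)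
  have hge : ∀ x ∈ closure O, s ≤ x (firstIdx N hN) := fun x hx =>
    closure_minimal (fun z hz => hz.2.le) (isClosed_le continuous_const hcoord) hx
  have hfr : ∀ x ∈ frontier O, y x ≤ y (reflectH hN s x) := by
    intro x hx
    rw [hOo.frontier_eq] at hx
    by_cases hxΩ : x ∈ Ω
    · have : x (firstIdx N hN) = s :=
        le_antisymm (not_lt.1 fun h => hx.2 ⟨hxΩ, h⟩) (hge x hx.1)
      rw [reflectH_of_apply_eq hN this]
    · rw [hout x (hclo hx.1) hxΩ]
      exact hnn _ (hmaps' hx.1)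
  have hw := hyw.isC1WeakSolution hp hΩo hy1 (continuousOn_const.mul
    (hy1.continuousOn.rpow_const fun x hx => Or.inl (hypos x hx).ne'))
  have hwu : IsC1WeakSolution p O y fun x => pLambda1 p Ω * y x ^ (p - 1) := by
    simpa using hw.comp_isometry (O := O) (LinearIsometryEquiv.refl ℝ _) 0
      fun x hx => by simpa using hOΩ hx
  have hwv : IsC1WeakSolution p O (fun x => y (reflectH hN s x))
      fun x => pLambda1 p Ω * y (reflectH hN s x) ^ (p - 1) := by
    simp only [reflectH_eq]
    exact hw.comp_isometry (reflectLinear hN) _ fun x hx => reflectH_eq hN s x ▸ hmaps hx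
  by_contra! hlt
  set a := s • e1v hN with ha
  set d := x₀ - a with hd
  have hd0 : r0 < ‖d‖ := ((mem_annulus hN hr0).1 hx₀).2
  have hline : Continuous fun t : ℝ => a + t • d := by fun_prop
  have hx₀1 : a + (1 : ℝ) • d = x₀ := by rw [one_smul, hd, add_sub_cancel]
  have hline1 : ∀ t : ℝ, 1 ≤ t → s < (a + t • d) (firstIdx N hN) := fun t ht => by
    have : (a + t • d) (firstIdx N hN) = s + t * (x₀ (firstIdx N hN) - s) := by
      simp [ha, hd, e1v_apply_firstIdx]
    rw [this]
    nlinarith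
  have hline0 : ∀ t : ℝ, 1 ≤ t → r0 < ‖a + t • d - s • e1v hN‖ := fun t ht => by
    rw [← ha, add_sub_cancel_left, norm_smul, Real.norm_of_nonneg (by linarith)]
    nlinarith [norm_nonneg d]
  have hr1 : 0 < r1 := (norm_nonneg _).trans_lt ((mem_annulus hN hr0).1 hx₀).1
  have hna : ‖a‖ = s := by rw [ha, norm_smul, norm_e1v, mul_one, Real.norm_of_nonneg hs.le]
  obtain ⟨T, hT, hTr, hTlt⟩ := exists_first_le (f := fun t : ℝ => ‖a + t • d‖) (a := 1)
    (b := 1 + (r1 + s) / r0) (c := r1) (by linarith [div_pos (add_pos hr1 hs) hr0])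
    hline.norm.continuousOn (by
      have h1 : (r1 + s) / r0 * r0 = r1 + s := div_mul_cancel₀ _ hr0.ne'
      have h2 : 0 < (r1 + s) / r0 := div_pos (add_pos hr1 hs) hr0
      have h3 := norm_sub_le (a + (1 + (r1 + s) / r0) • d) a
      rw [add_sub_cancel_left, norm_smul, Real.norm_of_nonneg (by linarith), hna] at h3
      nlinarith)
  have hT1 : 1 ≠ T := by
    rintro rfl
    rw [hx₀1] at hTr
    exact absurd hTr (not_le.2 ((mem_annulus hN hr0).1 hx₀).1)
  have hlineO : ∀ t ∈ Ico 1 T, a + t • d ∈ O := fun t ht =>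
    ⟨(mem_annulus hN hr0).2 ⟨hTlt t ht, hline0 t ht.1⟩, hline1 t ht.1⟩
  have hlinecl : MapsTo (fun t : ℝ => a + t • d) (Icc 1 T) (closure O) := by
    have : MapsTo (fun t : ℝ => a + t • d) (Ico 1 T) O := hlineO
    have := this.closure hline
    rwa [closure_Ico hT1] at this
  have hTcl := hlinecl (right_mem_Icc.2 hT.1)
  have hTle : ‖a + T • d‖ ≤ r1 := by
    have : closure O ⊆ closedBall 0 r1 :=
      closure_minimal ((hOΩ.trans sdiff_subset).trans ball_subset_closedBall) isClosed_closedBall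
    simpa using this hTcl
  have hyT : y (a + T • d) = 0 :=
    hout _ (hclo hTcl) fun h => absurd ((mem_annulus hN hr0).1 h).1 (not_lt.2 hTr)
  have hvline : ∀ t ∈ Icc 1 T, 0 < y (reflectH hN s (a + t • d)) := by
    intro t ht
    rcases ht.2.eq_or_lt with rfl | h
    · exact hypos _ (reflectH_mem_annulus hN hr0 hs (hline1 _ ht.1) hTle (hline0 _ ht.1))
    · exact hvpos _ (hlineO t ⟨ht.1, h⟩)
  have hmain := lt_of_hasDerivWithinAt_zero (c := 1)
    (q := fun t : ℝ => y (a + t • d) / y (reflectH hN s (a + t • d))) hT.1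
    (((hyc.mono hclo).comp hline.continuousOn hlinecl).div
      (hvc.comp hline.continuousOn hlinecl) fun t ht => (hvline t ht).ne')
    (by
      rw [hx₀1]
      exact (one_lt_div (hvpos x₀ ⟨hx₀, hsx₀⟩)).2 hlt)
    fun t ht hqt => by
      have htO := hlineO t ht
      have hlog := logGradient_eq_of_lt hp hOo hcpt (hyc.mono hclo) hvc (hy1.mono hOΩ) hv1
        (fun x hx => hypos x (hOΩ hx)) hvpos hfr hwu hwv htO ((one_lt_div (hvpos _ htO)).1 hqt)
      exact (hasDerivAt_div_line (u := y) (v := fun x => y (reflectH hN s x))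
        (((hy1.mono hOΩ).differentiableOn one_ne_zero).differentiableAt (hOo.mem_nhds htO))
        ((hv1.differentiableOn one_ne_zero).differentiableAt (hOo.mem_nhds htO))
        (hypos _ (hOΩ htO)).ne' (hvpos _ htO).ne' hlog).hasDerivWithinAt
  simp only [hyT, zero_div] at hmain
  linarith

/-- Reflection comparison for the first eigenfunction: for `s ∈ (0, r1-r0)` and
`x` in the half-domain `O = {x ∈ Ω(s) : x₁ > s}`, assuming existence and uniqueness of
nonnegative solutions of the associated boundary value problems on `O`, one has
`y_{1,s}(x') ≥ y_{1,s}(x)`, where `x'` is the reflection of `x` across `{x₁ = s}`. -/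
theorem reflection_comparison_eigenfunction
    (N : ℕ) (hN : 2 ≤ N) (p : ℝ) (hp : 1 < p) (r0 r1 : ℝ)
    (hr0 : 0 < r0) (hr01 : r0 < r1)
    (s : ℝ) (hs : s ∈ Set.Ioo 0 (r1 - r0))
    (y1 : EuclideanSpace ℝ (Fin N) → ℝ)
    (hy1 : IsFirstEigenfun p (annulus hN r0 r1 s) y1)
    (O : Set (EuclideanSpace ℝ (Fin N)))
    (hO : O = {x ∈ annulus hN r0 r1 s | s < x (firstIdx N hN)})
    (hexuniq : ∀ h' : EuclideanSpace ℝ (Fin N) → ℝ,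
      ContinuousOn h' (frontier O) → (∀ x ∈ frontier O, 0 ≤ h' x) →
      ∃ w, SolClass p O
          (fun _ t => pLambda1 p (annulus hN r0 r1 s) * (|t| ^ (p - 2) * t)) h' w ∧
        ∀ w', SolClass p O
            (fun _ t => pLambda1 p (annulus hN r0 r1 s) * (|t| ^ (p - 2) * t)) h' w' →
          ∀ x ∈ closure O, w' x = w x) :
    ∀ x ∈ O, y1 x ≤ y1 (reflectH hN s x) := by
  intro x hx
  rw [hO] at hx
  exact eigenfunction_le_comp_reflectH hN hp hr0 hs.1 hy1 hx.1 hx.2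

end
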